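/- arXiv:1704.06536 — 3 statements merged into one kernel-verified Lean document; each statement's English description precedes it below -/
import Mathlib

section
/- Let G be a connected graph and A ⊆ V(G) a set of k ≥ 2 vertices. If H is an induced connected subgraph of G containing A that is minimal (with respect to vertex deletion) among induced connected subgraphs containing A, then H has maximum degree at most k. -/
theorem aux_avoid {V : Type*} (G : SimpleGraph V) (S : Set V) {v w w' : V} (hw : G.Adj v w)
    (hw' : G.Adj v w') (hne : w ≠ w') {u z : V} (p : G.Walk u z) (hz : z = v)
    (hp : ∀ x ∈ p.support, x ∈ S) :
    ∃ q : G.Walk u z, (∀ x ∈ q.support, x ∈ S) ∧ (w ∉ q.support ∨ w' ∉ q.support) := by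
  classical
  induction p with
  | nil =>
    subst hz
    refine ⟨.nil, hp, ?_⟩
    left
    simpa using hw.ne'
  | @cons a b c h p ih =>
    subst hz
    have haS : a ∈ S := hp a (by simp)
    have hcS : c ∈ S := hp c (by simp)
    obtain ⟨q, hq, hq'⟩ := ih rfl (fun x hx => hp x (by simp [hx]))
    by_cases h1 : a = w
    · subst h1
      refine ⟨.cons hw.symm .nil, ?_, Or.inr ?_⟩
      · simp [haS, hcS]
      · simp [hne.symm, hw'.ne']
    by_cases h2 : a = w'
    · subst h2
      refine ⟨.cons hw'.symm .nil, ?_, Or.inl ?_⟩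
      · simp [haS, hcS]
      · simp [hne, hw.ne']
    refine ⟨.cons h q, ?_, ?_⟩
    · simpa [haS] using hq
    · simpa [Ne.symm h1, Ne.symm h2, eq_comm, h1, h2] using hq'

/-- If `H = G.induce S` is a minimal induced connected subgraph of a
connected graph `G` containing a set `A` of `k ≥ 2` vertices, then `H` has maximum
degree at most `k`. -/
theorem minimal_connected_subgraph_maxDegree {V : Type*} [Fintype V]
    (G : SimpleGraph V) (hG : G.Connected) (A S : Set V) (k : ℕ) (hk : 2 ≤ k)
    (hA : A.ncard = k) (hAS : A ⊆ S) (hconn : (G.induce S).Connected)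
    (hmin : ∀ S' : Set V, S' ⊆ S → A ⊆ S' → (G.induce S').Connected → S' = S) :
    ∀ v ∈ S, {w ∈ S | G.Adj v w}.ncard ≤ k := by
  classical
  intro v hv
  have key : ∀ w ∈ {w ∈ S | G.Adj v w}, ∃ a ∈ A,
      ∀ p : G.Walk a v, (∀ x ∈ p.support, x ∈ S) → w ∈ p.support := by
    rintro w ⟨hwS, hvw⟩
    by_contra! hcon
    let S' : Set V := {u | ∃ p : G.Walk u v, (∀ x ∈ p.support, x ∈ S) ∧ w ∉ p.support}
    have hS' : S' = S := by
      apply hmin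
      · rintro u ⟨p, hp, -⟩
        exact hp u p.start_mem_support
      · exact hcon
      · refine SimpleGraph.induce_connected_of_patches v ⟨.nil, by simpa using hv,
          by simpa using hvw.ne'⟩ ?_
        rintro u ⟨p, hp, hwp⟩
        refine ⟨{x | x ∈ p.support}, ?_, p.end_mem_support, p.start_mem_support,
          p.connected_induce_support _ _⟩
        intro x hx
        exact ⟨p.dropUntil x hx, fun y hy => hp y (p.support_dropUntil_subset_support hx hy),
          fun hy => hwp (p.support_dropUntil_subset_support hx hy)⟩
    have : w ∈ S' := hS' ▸ hwS
    obtain ⟨p, -, hp⟩ := this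
    exact hp p.start_mem_support
  choose! f hfA hf using key
  rw [← hA]
  refine Set.ncard_le_ncard_of_injOn f hfA ?_ (Set.toFinite _)
  intro w hw w' hw' heq
  by_contra hne
  obtain ⟨p⟩ := hconn ⟨f w, hAS (hfA w hw)⟩ ⟨v, hv⟩
  have hmap : ∀ x ∈ (p.map (SimpleGraph.Embedding.induce S).toHom).support, x ∈ S := by
    intro x hx
    rw [SimpleGraph.Walk.support_map, List.mem_map] at hx
    obtain ⟨y, -, rfl⟩ := hx
    exact y.2
  obtain ⟨p', hp'⟩ : ∃ p' : G.Walk (f w) v, ∀ x ∈ p'.support, x ∈ S := ⟨_, hmap⟩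
  obtain ⟨q, hq, h | h⟩ := aux_avoid G S hw.2 hw'.2 hne p' rfl hp'
  · exact h (hf w hw q hq)
  · have := hf w' hw'
    rw [← heq] at this
    exact h (this q hq)
end

section
/- Let G be a connected graph and A ⊆ V(G) with |A| = k ≥ 2. Every minimal induced connected subgraph H of G containing A admits a partition of V(H) into sets R and B such that |R| ≤ k−2 and the subgraph of H induced by B is a disjoint union of at most k−1 paths. -/
open SimpleGraph in
/-- an injective labelling with consecutive labels on edges forces acyclicity -/
lemma aux_acyclic {W : Type*} (G : SimpleGraph W) (g : W → ℕ) (hg : Function.Injective g)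
    (h : ∀ u v, G.Adj u v → g u = g v + 1 ∨ g v = g u + 1) : G.IsAcyclic := by
  classical
  intro v c hc
  obtain ⟨m, hm, hmax⟩ := Finset.exists_max_image c.support.toFinset g ⟨v, by simp⟩
  have hm' : m ∈ c.support := by simpa using hm
  have hc' := (Walk.isCycle_rotate hm').2 hc
  have key : ∀ w ∈ (c.rotate m hm').support, g w ≤ g m := by
    intro w hw
    exact hmax w (by simpa using (Walk.mem_support_rotate_iff c m hm').1 hw)
  have h1 := h _ _ (Walk.adj_snd hc'.not_nil)
  have h2 := h _ _ (Walk.adj_penultimate hc'.not_nil)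
  have k1 := key _ (Walk.getVert_mem_support _ 1)
  have k2 := key _ (Walk.getVert_mem_support _ ((c.rotate m hm').length - 1))
  apply hc'.snd_ne_penultimate
  apply hg
  simp only [Walk.snd, Walk.penultimate] at *
  omega

/-- reachability inside a vertex set -/
def RIn {V : Type*} (G : SimpleGraph V) (B : Set V) (u v : V) : Prop :=
  ∃ (hu : u ∈ B) (hv : v ∈ B), (G.induce B).Reachable ⟨u, hu⟩ ⟨v, hv⟩

lemma RIn.mono {V : Type*} {G : SimpleGraph V} {B B' : Set V} (h : B ⊆ B') {u v : V}
    (hr : RIn G B u v) : RIn G B' u v := by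
  obtain ⟨hu, hv, r⟩ := hr
  exact ⟨h hu, h hv, r.map (G.induceHomOfLE h).toHom⟩

lemma RIn.trans {V : Type*} {G : SimpleGraph V} {B : Set V} {u v w : V}
    (h1 : RIn G B u v) (h2 : RIn G B v w) : RIn G B u w := by
  obtain ⟨hu, hv, r⟩ := h1
  obtain ⟨_, hw, r'⟩ := h2
  exact ⟨hu, hw, r.trans r'⟩

lemma RIn.symm {V : Type*} {G : SimpleGraph V} {B : Set V} {u v : V}
    (h1 : RIn G B u v) : RIn G B v u := by
  obtain ⟨hu, hv, r⟩ := h1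
  exact ⟨hv, hu, r.symm⟩

lemma RIn.of_adj {V : Type*} {G : SimpleGraph V} {B : Set V} {u v : V}
    (hu : u ∈ B) (hv : v ∈ B) (h : G.Adj u v) : RIn G B u v :=
  ⟨hu, hv, SimpleGraph.Adj.reachable (by simpa using h)⟩

lemma RIn.seg {V : Type*} {G : SimpleGraph V} {B : Set V} (f : ℕ → V) (n : ℕ)
    (hB : ∀ i, i ≤ n → f i ∈ B) (hadj : ∀ i, i < n → G.Adj (f i) (f (i + 1))) :
    ∀ i, i ≤ n → RIn G B (f 0) (f i) := by
  intro i
  induction i with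
  | zero => intro h; exact ⟨hB _ h, hB _ h, SimpleGraph.Reachable.refl _⟩
  | succ i ih =>
    intro h
    exact (ih (by omega)).trans (RIn.of_adj (hB _ (by omega)) (hB _ h) (hadj _ (by omega)))

lemma connected_of_RIn {V : Type*} {G : SimpleGraph V} {B : Set V} (a : V) (ha : a ∈ B)
    (h : ∀ b ∈ B, RIn G B a b) : (G.induce B).Connected := by
  rw [SimpleGraph.connected_iff_exists_forall_reachable]
  refine ⟨⟨a, ha⟩, fun b => ?_⟩
  obtain ⟨_, _, r⟩ := h b.1 b.2
  exact r

/-- A shortest path from a vertex to a set. -/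
lemma aux_path {V : Type*} [Finite V] (G : SimpleGraph V) (S T : Set V)
    (hS : (G.induce S).Connected) (hT : T ⊆ S) (hne : T.Nonempty) (a : V) (ha : a ∈ S) :
    ∃ (n : ℕ) (f : ℕ → V) (d : V → ℕ), f 0 = a ∧ f n ∈ T ∧
      (∀ i, i ≤ n → f i ∈ S ∧ d (f i) = i) ∧ (∀ i, i < n → G.Adj (f i) (f (i + 1))) ∧
      (∀ u ∈ S, ∀ v ∈ S, G.Adj u v → d v ≤ d u + 1) ∧ ∀ t ∈ T, n ≤ d t := by
  classical
  let d : V → ℕ := fun v => if h : v ∈ S then (G.induce S).dist ⟨a, ha⟩ ⟨v, h⟩ else 0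
  obtain ⟨t, ht, hmin⟩ := Set.exists_min_image T d (Set.toFinite T) hne
  obtain ⟨p, hp⟩ := hS.exists_walk_length_eq_dist ⟨a, ha⟩ ⟨t, hT ht⟩
  have hlip : ∀ u ∈ S, ∀ v ∈ S, G.Adj u v → d v ≤ d u + 1 := by
    intro u hu v hv huv
    have h1 : (G.induce S).Adj ⟨u, hu⟩ ⟨v, hv⟩ := by simpa using huv
    have h2 := hS.dist_triangle (u := ⟨a, ha⟩) (v := ⟨u, hu⟩) (w := ⟨v, hv⟩)
    have h3 := SimpleGraph.dist_le h1.toWalk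
    simp only [d, hu, hv, dif_pos]
    simp at h3
    omega
  have hdt : d t = p.length := by simp [d, hT ht, hp]
  let f : ℕ → V := fun i => (p.getVert i).1
  have hfS : ∀ i, f i ∈ S := fun i => (p.getVert i).2
  have hadj : ∀ i, i < p.length → G.Adj (f i) (f (i + 1)) := by
    intro i hi
    simpa using p.adj_getVert_succ hi
  have hf0 : f 0 = a := by simp [f]
  have hfn : f p.length = t := by simp [f]
  have hstep : ∀ i j, i + j ≤ p.length → d (f (i + j)) ≤ d (f i) + j := by
    intro i j
    induction j with
    | zero => simp
    | succ j ih =>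
      intro h
      have := ih (by omega)
      have h2 := hlip _ (hfS (i + j)) _ (hfS (i + j + 1)) (hadj _ (by omega))
      rw [← add_assoc]
      omega
  refine ⟨p.length, f, d, hf0, by rw [hfn]; exact ht, ?_, hadj, hlip, ?_⟩
  · intro i hi
    refine ⟨hfS i, ?_⟩
    have h0 : d (f 0) = 0 := by rw [hf0]; simp [d, ha]
    have h1 := hstep 0 i (by omega)
    have h2 := hstep i (p.length - i) (by omega)
    rw [show i + (p.length - i) = p.length by omega, hfn] at h2
    simp only [zero_add] at h1
    omega
  · intro t' ht'
    rw [← hdt]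
    exact hmin t' ht'

/-- `B` induces a linear forest, whose components all meet `C`. -/
def Lin {V : Type*} (G : SimpleGraph V) (B C : Set V) : Prop :=
  ∃ g : V → ℕ, Set.InjOn g B ∧
    (∀ u ∈ B, ∀ v ∈ B, G.Adj u v → g u = g v + 1 ∨ g v = g u + 1) ∧
    ∀ b ∈ B, ∃ c ∈ C, RIn G B c b

lemma aux_main {V : Type*} [Finite V] (G : SimpleGraph V) (S : Set V)
    (hS : (G.induce S).Connected) (k : ℕ) (hk : 2 ≤ k) :
    ∀ A : Set V, A.ncard = k → A ⊆ S → ∃ T R B C : Set V, A ⊆ T ∧ T ⊆ S ∧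
      (G.induce T).Connected ∧ R ∪ B = T ∧ Disjoint R B ∧ R.ncard ≤ k - 2 ∧
      C.ncard ≤ k - 1 ∧ Lin G B C := by
  classical
  induction k, hk using Nat.le_induction with
  | base =>
    intro A hA hAS
    obtain ⟨a, b, hab, rfl⟩ := Set.ncard_eq_two.1 hA
    obtain ⟨n, f, d, hf0, hfn, hfd, hadj, hlip, -⟩ :=
      aux_path G S {b} hS (by intro x hx; exact hAS (Or.inr hx)) ⟨b, rfl⟩ a (hAS (by simp))
    have hseg := RIn.seg (G := G) (B := f '' Set.Iic n) f n (fun i hi => ⟨i, hi, rfl⟩) hadj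
    refine ⟨f '' Set.Iic n, ∅, f '' Set.Iic n, {a}, ?_, ?_, ?_, by simp, by simp, by simp,
      by simp, d, ?_, ?_, ?_⟩
    · rintro x (rfl | rfl)
      · exact ⟨0, by simp, hf0⟩
      · exact ⟨n, by simp, hfn⟩
    · rintro _ ⟨i, hi, rfl⟩
      exact (hfd i hi).1
    · refine connected_of_RIn (f 0) ⟨0, by simp, rfl⟩ ?_
      rintro _ ⟨i, hi, rfl⟩
      exact hseg i hi
    · rintro _ ⟨i, hi, rfl⟩ _ ⟨j, hj, rfl⟩ hij
      rw [(hfd i hi).2, (hfd j hj).2] at hij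
      rw [hij]
    · rintro _ ⟨i, hi, rfl⟩ _ ⟨j, hj, rfl⟩ hij
      have h1 := hlip _ (hfd i hi).1 _ (hfd j hj).1 hij
      have h2 := hlip _ (hfd j hj).1 _ (hfd i hi).1 hij.symm
      have h3 : i ≠ j := by rintro rfl; exact hij.ne rfl
      rw [(hfd i hi).2, (hfd j hj).2] at *
      omega
    · rintro _ ⟨i, hi, rfl⟩
      exact ⟨a, rfl, hf0 ▸ hseg i hi⟩
  | succ k hk ih =>
    intro A hA hAS
    obtain ⟨a, A', haA', rfl, hA'⟩ := Set.eq_insert_of_ncard_eq_succ hA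
    obtain ⟨T, R, B, C, hAT, hTS, hT, hRB, hdis, hR, hC, g, hinj, hg, hreach⟩ :=
      ih A' hA' (fun x hx => hAS (Or.inr hx))
    by_cases haT : a ∈ T
    · exact ⟨T, R, B, C, Set.insert_subset haT hAT, hTS, hT, hRB, hdis, by omega, by omega,
        g, hinj, hg, hreach⟩
    have hne : T.Nonempty := by
      obtain ⟨x⟩ := hT.nonempty
      exact ⟨x.1, x.2⟩
    obtain ⟨n, f, d, hf0, hfn, hfd, hadj, hlip, hmin⟩ :=
      aux_path G S T hS hTS hne a (hAS (Or.inl rfl))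
    obtain ⟨m, rfl⟩ : ∃ m, n = m + 1 := by
      refine ⟨n - 1, ?_⟩
      rcases Nat.eq_zero_or_pos n with rfl | h
      · rw [hf0] at hfn; exact absurd hfn haT
      · omega
    have hfT : ∀ i, i ≤ m → f i ∉ T := by
      intro i hi h
      have h1 := hmin _ h
      rw [(hfd i (by omega)).2] at h1
      omega
    have hfinj : ∀ i j, i ≤ m + 1 → j ≤ m + 1 → f i = f j → i = j := by
      intro i j hi hj h
      rw [← (hfd i hi).2, h, (hfd j hj).2]
    have hnadj : ∀ i, i < m → ∀ t ∈ T, ¬ G.Adj (f i) t := by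
      intro i hi t ht h
      have h1 := hmin _ ht
      have h2 := hlip _ (hfd i (by omega)).1 _ (hTS ht) h
      rw [(hfd i (by omega)).2] at h2
      omega
    have hBT : B ⊆ T := hRB ▸ Set.subset_union_right
    have hRT : R ⊆ T := hRB ▸ Set.subset_union_left
    obtain ⟨M, hM⟩ : ∃ M, ∀ b ∈ B, g b < M := by
      obtain ⟨M, hM⟩ := (Set.toFinite (g '' B)).bddAbove
      exact ⟨M + 1, fun b hb => Nat.lt_succ_of_le (hM ⟨b, hb, rfl⟩)⟩
    have hTU : T ⊆ T ∪ f '' Set.Iic m := Set.subset_union_left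
    refine ⟨T ∪ f '' Set.Iic m, insert (f m) R, B ∪ f '' Set.Iio m, insert a C,
      ?_, ?_, ?_, ?_, ?_, ?_, ?_, fun v => if v ∈ T then g v else M + 1 + d v, ?_, ?_, ?_⟩
    · refine Set.insert_subset (Or.inr ⟨0, by simp, hf0⟩) (hAT.trans hTU)
    · refine Set.union_subset hTS ?_
      rintro _ ⟨i, hi, rfl⟩
      exact (hfd i (Nat.le_succ_of_le hi)).1
    · have hseg := RIn.seg (G := G) (B := T ∪ f '' Set.Iic m) f (m + 1) (by
        intro i hi
        rcases Nat.lt_or_ge m i with h | h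
        · obtain rfl : i = m + 1 := by omega
          exact Or.inl hfn
        · exact Or.inr ⟨i, h, rfl⟩) hadj
      refine connected_of_RIn (f 0) (Or.inr ⟨0, by simp, rfl⟩) ?_
      rintro b (hb | ⟨i, hi, rfl⟩)
      · refine (hseg (m + 1) le_rfl).trans (RIn.mono hTU ?_)
        exact ⟨hfn, hb, hT.preconnected _ _⟩
      · exact hseg i (Nat.le_succ_of_le hi)
    · rw [← hRB]
      ext x
      simp only [Set.mem_union, Set.mem_insert_iff, Set.mem_image, Set.mem_Iio, Set.mem_Iic]
      constructor
      · rintro ((rfl | h) | (h | ⟨i, hi, rfl⟩))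
        · exact Or.inr ⟨m, le_rfl, rfl⟩
        · exact Or.inl (Or.inl h)
        · exact Or.inl (Or.inr h)
        · exact Or.inr ⟨i, hi.le, rfl⟩
      · rintro ((h | h) | ⟨i, hi, rfl⟩)
        · exact Or.inl (Or.inr h)
        · exact Or.inr (Or.inl h)
        · rcases hi.lt_or_eq with h | rfl
          · exact Or.inr (Or.inr ⟨i, h, rfl⟩)
          · exact Or.inl (Or.inl rfl)
    · rw [Set.disjoint_left]
      rintro x (rfl | hx) (hx' | ⟨i, hi, hix⟩)
      · exact hfT m le_rfl (hBT hx')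
      · have := hfinj i m (Nat.le_succ_of_le (le_of_lt hi)) (by omega) hix
        exact absurd hi (by simp [this])
      · exact Set.disjoint_left.1 hdis hx hx'
      · subst hix
        exact hfT i (le_of_lt hi) (hRT hx)
    · have := Set.ncard_insert_le (f m) R
      omega
    · have := Set.ncard_insert_le a C
      omega
    · rintro x (hx | ⟨i, hi, rfl⟩) y (hy | ⟨j, hj, rfl⟩) hxy
      · simp only [hBT hx, hBT hy, if_true] at hxy
        exact hinj hx hy hxy
      · simp only [hBT hx, hfT j (le_of_lt hj), if_true, if_false] at hxy
        have := hM x hx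
        omega
      · simp only [hBT hy, hfT i (le_of_lt hi), if_true, if_false] at hxy
        have := hM y hy
        omega
      · simp only [hfT j (le_of_lt hj), hfT i (le_of_lt hi), if_false] at hxy
        rw [(hfd i (Nat.le_succ_of_le (le_of_lt hi))).2,
          (hfd j (Nat.le_succ_of_le (le_of_lt hj))).2] at hxy
        rw [show i = j by omega]
    · rintro x (hx | ⟨i, hi, rfl⟩) y (hy | ⟨j, hj, rfl⟩) hxy
      · simp only [hBT hx, hBT hy, if_true]
        exact hg x hx y hy hxy
      · exact absurd hxy.symm (hnadj j hj x (hBT hx))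
      · exact absurd hxy (hnadj i hi y (hBT hy))
      · simp only [hfT j (le_of_lt hj), hfT i (le_of_lt hi), if_false]
        have ei := hfd i (Nat.le_succ_of_le (le_of_lt hi))
        have ej := hfd j (Nat.le_succ_of_le (le_of_lt hj))
        have h1 := hlip _ ei.1 _ ej.1 hxy
        have h2 := hlip _ ej.1 _ ei.1 hxy.symm
        have h3 : i ≠ j := by rintro rfl; exact hxy.ne rfl
        rw [ei.2, ej.2] at *
        omega
    · rintro b (hb | ⟨i, hi, rfl⟩)
      · obtain ⟨c, hc, hr⟩ := hreach b hb
        exact ⟨c, Or.inr hc, hr.mono Set.subset_union_left⟩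
      · refine ⟨a, Or.inl rfl, ?_⟩
        rw [← hf0]
        exact RIn.seg f i (fun j hj => Or.inr ⟨j, lt_of_le_of_lt hj hi, rfl⟩)
          (fun j hj => hadj j (by have : i < m := hi; omega)) i le_rfl


/-- Every minimal induced connected subgraph `H = G.induce S` of a
connected graph `G` containing a set `A` with `|A| = k ≥ 2` admits a partition of
its vertex set into `R` and `B` with `|R| ≤ k - 2` such that the subgraph induced
on `B` is a disjoint union of at most `k - 1` paths (i.e. it is acyclic, has
maximum degree at most 2, and has at most `k - 1` connected components). -/
theorem minimal_connected_subgraph_red_blue {V : Type*} [Fintype V]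
    (G : SimpleGraph V) (hG : G.Connected) (A S : Set V) (k : ℕ) (hk : 2 ≤ k)
    (hA : A.ncard = k) (hAS : A ⊆ S) (hconn : (G.induce S).Connected)
    (hmin : ∀ S' : Set V, S' ⊆ S → A ⊆ S' → (G.induce S').Connected → S' = S) :
    ∃ R B : Set V, R ∪ B = S ∧ Disjoint R B ∧ R.ncard ≤ k - 2 ∧
      (G.induce B).IsAcyclic ∧
      (∀ v : B, ((G.induce B).neighborSet v).ncard ≤ 2) ∧
      Nat.card (G.induce B).ConnectedComponent ≤ k - 1 := by
  classical
  obtain ⟨T, R, B, C, hAT, hTS, hT, hRB, hdis, hR, hC, g, hinj, hg, hreach⟩ :=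
    aux_main G S hconn k hk A hA hAS
  have hTS' := hmin T hTS hAT hT
  refine ⟨R, B, hRB.trans hTS', hdis, hR, ?_, ?_, ?_⟩
  · refine aux_acyclic _ (fun v : B => g v.1) ?_ ?_
    · intro u v h
      exact Subtype.ext (hinj u.2 v.2 h)
    · intro u v h
      exact hg _ u.2 _ v.2 (by simpa using h)
  · intro v
    have hi : Set.InjOn (fun w : B => g w.1) ((G.induce B).neighborSet v) := by
      intro u _ w _ h
      exact Subtype.ext (hinj u.2 w.2 h)
    rw [← hi.ncard_image]
    have hsub : (fun w : B => g w.1) '' ((G.induce B).neighborSet v) ⊆ {g v - 1, g v + 1} := by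
      rintro _ ⟨w, hw, rfl⟩
      have := hg _ v.2 _ w.2 (by simpa using hw)
      simp only [Set.mem_insert_iff, Set.mem_singleton_iff]
      omega
    exact (Set.ncard_le_ncard hsub (Set.toFinite _)).trans ((Set.ncard_insert_le _ _).trans (by simp))
  · refine le_trans ?_ hC
    choose c hcC hcr using hreach
    have hex : ∀ q : (G.induce B).ConnectedComponent, ∃ x : C, ∃ h : x.1 ∈ B,
        (G.induce B).connectedComponentMk ⟨x.1, h⟩ = q := by
      intro q
      induction q using SimpleGraph.ConnectedComponent.ind with
      | _ b =>
        obtain ⟨h1, _, r⟩ := hcr b.1 b.2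
        exact ⟨⟨_, hcC b.1 b.2⟩, h1, SimpleGraph.ConnectedComponent.eq.2 r⟩
    choose F hF hFq using hex
    rw [← Nat.card_coe_set_eq]
    refine Nat.card_le_card_of_injective F ?_
    intro p q h
    rw [← hFq p, ← hFq q]
    congr 2
    rw [h]
end

section
/- Let G be a graph admitting a tree T and a T-partition (T_x : x ∈ V(T)) such that each bag T_x has at most b vertices and, for every edge xy of T, at most a edges of G join the union of bags in the component of T−xy containing x to the union of bags in the component containing y. Then G admits a 2-colouring in which every vertex has at most b·(a−1) + (b−1) neighbours of its own colour (in particular, defect less than b·a). -/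
/-- Defective colouring of a graph on a well order, with cuts `sub x`. -/
theorem quotient_colouring {ι : Type*} [LinearOrder ι] [WellFoundedLT ι]
    (Q : SimpleGraph ι) (sub : ι → Set ι) (a : ℕ)
    (hself : ∀ x, x ∈ sub x) (hsub : ∀ x y, y ∈ sub x → x ≤ y)
    (hfin : ∀ x, {p : ι × ι | p.1 ∈ sub x ∧ p.2 ∉ sub x ∧ Q.Adj p.1 p.2}.Finite)
    (hnb : ∀ x, {y | Q.Adj x y}.Finite)
    (hcut : ∀ x, {p : ι × ι | p.1 ∈ sub x ∧ p.2 ∉ sub x ∧ Q.Adj p.1 p.2}.ncard ≤ a) :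
    ∃ c : ι → Bool, ∀ x, {y | Q.Adj x y ∧ c y = c x}.ncard ≤ a - 1 := by
  classical
  -- minimal neighbour
  have hm : ∀ x, ∃ m, (∃ y, Q.Adj x y) → Q.Adj x m ∧ ∀ y, Q.Adj x y → m ≤ y := by
    intro x
    by_cases h : ∃ y, Q.Adj x y
    · obtain ⟨m, hm, hmin⟩ := WellFounded.has_min (wellFounded_lt (α := ι)) {y | Q.Adj x y} h
      exact ⟨m, fun _ => ⟨hm, fun y hy => not_lt.1 (hmin y hy)⟩⟩
    · exact ⟨x, fun h' => absurd h' h⟩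
  choose m hm using hm
  have hadj : ∀ x y, Q.Adj x y → Q.Adj x (m x) := fun x y h => (hm x ⟨y, h⟩).1
  have hmin : ∀ x y, Q.Adj x y → m x ≤ y := fun x y h => (hm x ⟨y, h⟩).2 y h
  -- the colouring
  have hc : ∃ c : ι → Bool, (∀ x, Q.Adj x (m x) → m x < x → c x = !(c (m x))) ∧
      (∀ x, ¬ (Q.Adj x (m x) ∧ m x < x) → (∃ y, Q.Adj x y ∧ m y < x) →
        ∃ y, Q.Adj x y ∧ m y < x ∧ c x = c (m y)) := by
    let F : (x : ι) → ((y : ι) → y < x → Bool) → Bool := fun x rec =>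
      if h : Q.Adj x (m x) ∧ m x < x then !(rec (m x) h.2)
      else if h' : ∃ y, Q.Adj x y ∧ m y < x then rec (m h'.choose) h'.choose_spec.2
      else true
    let c : ι → Bool := (wellFounded_lt (α := ι)).fix F
    have hF : ∀ x, c x = F x (fun y _ => c y) := fun x => WellFounded.fix_eq _ _ _
    refine ⟨c, fun x h1 h2 => ?_, fun x h1 h2 => ?_⟩
    · rw [hF]; simp only [F]; rw [dif_pos ⟨h1, h2⟩]
    · refine ⟨h2.choose, h2.choose_spec.1, h2.choose_spec.2, ?_⟩
      rw [hF]; simp only [F]; rw [dif_neg h1, dif_pos h2]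
  obtain ⟨c, hc1, hc2⟩ := hc
  refine ⟨c, fun x => ?_⟩
  set B := {y | Q.Adj x y ∧ c y = c x} with hB
  rcases B.eq_empty_or_nonempty with h0 | ⟨y1, hy1⟩
  · rw [h0]; simp
  have hBfin : B.Finite := (hnb x).subset (fun y hy => hy.1)
  -- later bad neighbours
  have key : ∀ y, y ∈ B → x < y → m y < x := by
    intro y hy hxy
    refine lt_of_le_of_ne (hmin y x hy.1.symm) fun h => ?_
    have := hc1 y (h ▸ hy.1.symm) (h ▸ hxy)
    rw [h, hy.2] at this
    simp at this
  let g : ι → ι × ι := fun y => if y ∈ sub x then (y, m y) else (x, y)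
  have hginj : Set.InjOn g {y | Q.Adj x y} := by
    intro y hy z hz h
    have hy' := hy.ne
    have hz' := hz.ne
    simp only [g] at h
    split_ifs at h <;> simp only [Prod.mk.injEq] at h <;> grind
  have hgB : ∀ y, Q.Adj x y → (y ∈ sub x → m y < x) →
      g y ∈ {p : ι × ι | p.1 ∈ sub x ∧ p.2 ∉ sub x ∧ Q.Adj p.1 p.2} := by
    intro y hy h
    by_cases hs : y ∈ sub x
    · simp only [g, if_pos hs]
      exact ⟨hs, fun h' => absurd (hsub _ _ h') (not_le.2 (h hs)), hadj _ _ hy.symm⟩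
    · simp only [g, if_neg hs]
      exact ⟨hself x, hs, hy⟩
  have hy0 : ∃ y0, Q.Adj x y0 ∧ y0 ∉ B ∧ (y0 ∈ sub x → m y0 < x) := by
    by_cases hx : Q.Adj x (m x) ∧ m x < x
    · refine ⟨m x, hx.1, fun h => ?_, fun h => absurd (hsub _ _ h) (not_le.2 hx.2)⟩
      have h1 := hc1 x hx.1 hx.2
      rw [h.2] at h1
      simp at h1
    · have hgt : ∀ y, Q.Adj x y → x < y := by
        intro y hy
        by_contra hlt
        have : y < x := lt_of_le_of_ne (not_lt.1 hlt) hy.ne'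
        exact hx ⟨hadj _ _ hy, (hmin _ _ hy).trans_lt this⟩
      obtain ⟨y, hy, hyx, hcy⟩ := hc2 x hx ⟨y1, hy1.1, key y1 hy1 (hgt _ hy1.1)⟩
      refine ⟨y, hy, fun h => ?_, fun _ => hyx⟩
      have h1 := hc1 y (hadj _ _ hy.symm) (hyx.trans (hgt y hy))
      rw [← hcy, h.2] at h1
      simp at h1
  obtain ⟨y0, hy0, hy0B, hy0s⟩ := hy0
  have hle : (insert y0 B).ncard ≤ a := by
    refine le_trans ?_ (hcut x)
    refine Set.ncard_le_ncard_of_injOn g ?_ ?_ (hfin x)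
    · rintro y (rfl | hy)
      · exact hgB _ hy0 hy0s
      · exact hgB _ hy.1 fun hs => key y hy (lt_of_le_of_ne (hsub _ _ hs) hy.1.ne)
    · refine hginj.mono ?_
      rintro y (rfl | hy)
      · exact hy0
      · exact hy.1
  rw [Set.ncard_insert_of_notMem hy0B hBfin] at hle
  omega

/-- In a rooted tree, the side of the parent edge. -/
theorem tree_parent_cut {ι : Type*} (T : SimpleGraph ι) (hT : T.IsTree) (r x : ι) (hx : x ≠ r) :
    ∃ y, T.Adj x y ∧
      (∀ z, (T.deleteEdges {s(x, y)}).Reachable x z ∨ (T.deleteEdges {s(x, y)}).Reachable y z) ∧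
      (∀ z, (T.deleteEdges {s(x, y)}).Reachable x z → z ≠ x → T.dist r x < T.dist r z) := by
  obtain ⟨p, hp⟩ := hT.connected.exists_walk_length_eq_dist x r
  cases p with
  | nil => exact absurd rfl hx
  | @cons _ y _ h q =>
    have hq : x ∉ q.support := by
      classical
      intro hmem
      have h1 := SimpleGraph.dist_le (q.dropUntil x hmem)
      have h2 := q.length_dropUntil_le_length hmem
      simp only [SimpleGraph.Walk.length_cons] at hp
      omega
    have hedge : ∀ {u v : ι} (w : T.Walk u v), x ∉ w.support →
        (T.deleteEdges {s(x, y)}).Reachable u v := by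
      intro u v w hw
      refine ⟨w.toDeleteEdges _ ?_⟩
      rintro e he rfl
      exact hw (w.fst_mem_support_of_mem_edges he)
    have hbr : ¬ (T.deleteEdges {s(x, y)}).Reachable x y := by
      have := (SimpleGraph.isAcyclic_iff_forall_adj_isBridge.1 hT.isAcyclic) h
      exact SimpleGraph.isBridge_iff.1 this
    refine ⟨y, h, fun z => ?_, fun z hz hzx => ?_⟩
    · obtain ⟨w⟩ := hT.connected.preconnected z x
      have : ∀ {u v : ι} (w : T.Walk u v), v = x →
        (T.deleteEdges {s(x, y)}).Reachable x u ∨ (T.deleteEdges {s(x, y)}).Reachable y u := by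
        intro u v w
        induction w with
        | nil => rintro rfl; exact Or.inl (SimpleGraph.Reachable.refl _)
        | @cons u u' v hu w ih =>
          intro hv
          by_cases he : s(u, u') = s(x, y)
          · rcases Sym2.eq_iff.1 he with ⟨rfl, _⟩ | ⟨rfl, _⟩
            · exact Or.inl (SimpleGraph.Reachable.refl _)
            · exact Or.inr (SimpleGraph.Reachable.refl _)
          · have ha : (T.deleteEdges {s(x, y)}).Adj u' u := by
              rw [SimpleGraph.deleteEdges_adj]
              exact ⟨hu.symm, fun h' => he (Sym2.eq_swap.trans h')⟩
            exact (ih hv).imp (fun h => h.trans ha.reachable) (fun h => h.trans ha.reachable)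
      exact this w rfl
    · classical
      obtain ⟨w, hw⟩ := hT.connected.exists_walk_length_eq_dist r z
      have hxw : x ∈ w.support := by
        by_contra hn
        exact hbr (hz.trans ((hedge q hq).trans (hedge w hn)).symm)
      have h1 := SimpleGraph.dist_le (w.takeUntil x hxw)
      have h2 := w.length_takeUntil_lt_length hxw hzx.symm
      omega

/-- Existence of a well order refining a natural number valued height. -/
theorem exists_height_order {ι : Type*} (d : ι → ℕ) :
    ∃ L : LinearOrder ι, @WellFoundedLT ι L.toLT ∧ ∀ x y, d x < d y → L.lt x y := by
  classical
  obtain ⟨L0, hL0⟩ := exists_wellOrder ι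
  letI := L0
  let f : ι → ℕ ×ₗ ι := fun x => toLex (d x, x)
  have hf : Function.Injective f := fun x y h => (Prod.ext_iff.1 (toLex.injective h)).2
  refine ⟨LinearOrder.lift' f hf, ?_, fun x y h => ?_⟩
  · have : WellFounded (fun x y : ι => f x < f y) := InvImage.wf f wellFounded_lt
    exact ⟨this⟩
  · show f x < f y
    exact Prod.Lex.toLex_lt_toLex.2 (Or.inl h)


/-- Let `G` admit a `T`-partition `(bags x : x ∈ V(T))` over a tree
`T`, with each bag of size at most `b`, such that for every edge `xy` of `T` at
most `a` edges of `G` join the union of the bags in the component of `T - xy`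
containing `x` to the union of the bags in the component containing `y`. Then `G`
admits a 2-colouring in which every vertex has at most `b*(a-1) + (b-1)`
neighbours of its own colour. -/
theorem tree_partition_two_colouring {V : Type*} [Fintype V] {ι : Type*}
    (G : SimpleGraph V) (T : SimpleGraph ι) (hT : T.IsTree)
    (bags : ι → Set V) (a b : ℕ)
    (hdisj : ∀ x y : ι, x ≠ y → Disjoint (bags x) (bags y))
    (hcover : ∀ v : V, ∃ x : ι, v ∈ bags x)
    (hbag : ∀ x : ι, (bags x).ncard ≤ b)
    (hcut : ∀ x y : ι, T.Adj x y →
      {p : V × V |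
          (∃ z : ι, (T.deleteEdges {s(x, y)}).Reachable x z ∧ p.1 ∈ bags z) ∧
          (∃ z : ι, (T.deleteEdges {s(x, y)}).Reachable y z ∧ p.2 ∈ bags z) ∧
          G.Adj p.1 p.2}.ncard ≤ a) :
    ∃ c : V → Bool,
      ∀ v : V, {w : V | G.Adj v w ∧ c w = c v}.ncard ≤ b * (a - 1) + (b - 1) := by
  classical
  choose f hf using hcover
  have hfu : ∀ v x, v ∈ bags x → x = f v := by
    intro v x hv
    by_contra hne
    exact Set.disjoint_left.1 (hdisj _ _ hne) hv (hf v)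
  obtain ⟨r⟩ := hT.connected.nonempty
  obtain ⟨L, hwf, hL⟩ := exists_height_order (fun x => T.dist r x)
  letI := L
  haveI := hwf
  let Q : SimpleGraph ι :=
    { Adj := fun p q => p ≠ q ∧ ∃ u v, f u = p ∧ f v = q ∧ G.Adj u v
      symm := ⟨fun p q ⟨h, u, v, hu, hv, e⟩ => ⟨h.symm, v, u, hv, hu, e.symm⟩⟩
      loopless := ⟨fun p h => h.1 rfl⟩ }
  have hS : ∀ x, ∃ S : Set ι, x ∈ S ∧ (∀ y ∈ S, x ≤ y) ∧
      {p : ι × ι | p.1 ∈ S ∧ p.2 ∉ S ∧ Q.Adj p.1 p.2}.ncard ≤ a := by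
    intro x
    by_cases hx : x = r
    · refine ⟨Set.univ, trivial, fun y _ => ?_, by simp⟩
      by_cases hy : y = x
      · exact hy.ge
      · refine le_of_lt (hL _ _ ?_)
        rw [hx, SimpleGraph.dist_self]
        exact hT.connected.pos_dist_of_ne (fun h => hy (h.symm.trans hx.symm))
    · obtain ⟨y, hxy, h1, h2⟩ := tree_parent_cut T hT r x hx
      refine ⟨{z | (T.deleteEdges {s(x, y)}).Reachable x z}, SimpleGraph.Reachable.refl _,
        fun z hz => ?_, ?_⟩
      · by_cases hzx : z = x
        · exact hzx.ge
        · exact le_of_lt (hL _ _ (h2 z hz hzx))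
      · refine le_trans ?_ (hcut x y hxy)
        refine le_trans (Set.ncard_le_ncard ?_ ((Set.toFinite _).image
          (fun p : V × V => (f p.1, f p.2)))) (Set.ncard_image_le (Set.toFinite _))
        rintro ⟨p, q⟩ ⟨hp, hq, -, u, v, rfl, rfl, e⟩
        exact ⟨(u, v), ⟨⟨_, hp, hf u⟩, ⟨_, (h1 _).resolve_left hq, hf v⟩, e⟩, rfl⟩
  choose sub hs1 hs2 hs3 using hS
  have hnb : ∀ x, {y | Q.Adj x y}.Finite := fun x =>
    (Set.finite_range f).subset (by rintro y ⟨-, u, v, -, rfl, -⟩; exact ⟨v, rfl⟩)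
  obtain ⟨c, hc⟩ := quotient_colouring Q sub a hs1 hs2
    (fun x => (Set.finite_range (fun p : V × V => (f p.1, f p.2))).subset (by
      rintro ⟨p, q⟩ ⟨-, -, -, u, v, rfl, rfl, -⟩; exact ⟨(u, v), rfl⟩)) hnb hs3
  refine ⟨fun v => c (f v), fun v => ?_⟩
  have hBfin : {y | Q.Adj (f v) y ∧ c y = c (f v)}.Finite := (hnb (f v)).subset fun y hy => hy.1
  have hcov : {w : V | G.Adj v w ∧ c (f w) = c (f v)} ⊆
      ((hBfin.toFinset.biUnion fun y => (bags y).toFinset : Finset V) : Set V) ∪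
        (bags (f v) \ {v}) := by
    rintro w ⟨e, hw⟩
    by_cases h : f v = f w
    · right
      exact ⟨h ▸ hf w, e.ne'⟩
    · left
      simp only [Finset.coe_biUnion, Set.mem_iUnion]
      exact ⟨f w, by simpa using ⟨⟨h, v, w, rfl, rfl, e⟩, hw⟩, by simpa using hf w⟩
  refine (Set.ncard_le_ncard hcov (Set.toFinite _)).trans ((Set.ncard_union_le _ _).trans ?_)
  refine Nat.add_le_add ?_ ?_
  · rw [Set.ncard_coe_finset]
    refine (Finset.card_biUnion_le_card_mul _ _ b fun y _ => ?_).trans ?_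
    · rw [← Set.ncard_eq_toFinset_card']; exact hbag y
    · rw [← Set.ncard_eq_toFinset_card _ hBfin, mul_comm]
      exact Nat.mul_le_mul_left _ (hc (f v))
  · rw [Set.ncard_sdiff_singleton_of_mem (hf v)]
    exact Nat.sub_le_sub_right (hbag _) 1
end
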